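/- arXiv:2603.17245 — 2 statements merged into one kernel-verified Lean document; each statement's English description precedes it below -/
import Mathlib

section
/- Let N ≥ 1 and let f_1,…,f_N ∈ S = ℂ[x_1,…,x_N] be homogeneous polynomials of degrees e_1,…,e_N ≥ 1 forming a regular sequence, and let R = S ⧸ (f_1,…,f_N) and σ = ∑_{i=1}^N (e_i − 1). Then R_k = 0 for every k > σ; equivalently, every homogeneous polynomial of degree greater than σ lies in the ideal (f_1,…,f_N). -/
noncomputable section

open MvPolynomial

/-- The Jacobian ideal of `F`, generated by the partial derivatives of `F`. -/
def jacobianIdeal {N : ℕ} (F : MvPolynomial (Fin N) ℂ) : Ideal (MvPolynomial (Fin N) ℂ) :=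
  Ideal.span (Set.range fun i => pderiv i F)

/-- The degree-`k` graded piece of the quotient `S ⧸ I`: the image of the homogeneous
polynomials of degree `k` under the quotient map. -/
def gradedPiece {N : ℕ} (I : Ideal (MvPolynomial (Fin N) ℂ)) (k : ℕ) :
    Submodule ℂ (MvPolynomial (Fin N) ℂ ⧸ I) :=
  (homogeneousSubmodule (Fin N) ℂ k).map (Ideal.Quotient.mkₐ ℂ I).toLinearMap

/-- Multiplication on `S ⧸ I` by the residue class of `g : S`. -/
def mulMap {N : ℕ} (I : Ideal (MvPolynomial (Fin N) ℂ)) (g : MvPolynomial (Fin N) ℂ) :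
    (MvPolynomial (Fin N) ℂ ⧸ I) →ₗ[ℂ] (MvPolynomial (Fin N) ℂ ⧸ I) :=
  LinearMap.mulLeft ℂ (Ideal.Quotient.mk I g)


theorem hs_comp_mul {N : ℕ} {f : MvPolynomial (Fin N) ℂ} {e : ℕ} (hf : f.IsHomogeneous e)
    (b : MvPolynomial (Fin N) ℂ) (k : ℕ) :
    homogeneousComponent k (f * b) =
      if e ≤ k then f * homogeneousComponent (k - e) b else 0 := by
  have key : ∀ i, homogeneousComponent k (f * homogeneousComponent i b) =
      if e + i = k then f * homogeneousComponent i b else 0 := by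
    intro i
    have h := hf.mul (homogeneousComponent_isHomogeneous i b)
    rw [homogeneousComponent_of_mem h]
    simp only [eq_comm]
  conv_lhs => rw [← sum_homogeneousComponent b, Finset.mul_sum, map_sum]
  simp_rw [key]
  split_ifs with h
  · rw [Finset.sum_eq_single (k - e)]
    · rw [if_pos (by omega)]
    · intro i _ hi
      rw [if_neg (by omega)]
    · intro hi
      rw [if_pos (by omega), homogeneousComponent_eq_zero, mul_zero]
      simp at hi
      omega
  · apply Finset.sum_eq_zero
    intro i _
    rw [if_neg (by omega)]

/-- homogeneous part of an ideal in degree `k` -/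
def hsPart {N : ℕ} (I : Ideal (MvPolynomial (Fin N) ℂ)) (k : ℕ) :
    Submodule ℂ (MvPolynomial (Fin N) ℂ) :=
  homogeneousSubmodule (Fin N) ℂ k ⊓ I.restrictScalars ℂ

/-- closed under homogeneous components -/
def hsHom {N : ℕ} (I : Ideal (MvPolynomial (Fin N) ℂ)) : Prop :=
  ∀ g ∈ I, ∀ k, homogeneousComponent k g ∈ I

theorem hs_mem_part {N : ℕ} (I : Ideal (MvPolynomial (Fin N) ℂ)) (k : ℕ)
    (g : MvPolynomial (Fin N) ℂ) : g ∈ hsPart I k ↔ g.IsHomogeneous k ∧ g ∈ I := Iff.rfl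

instance hs_fin (N k : ℕ) : FiniteDimensional ℂ (homogeneousSubmodule (Fin N) ℂ k) :=
  Module.Finite.iff_fg.mpr (homogeneousSubmodule_fg _ _ k)

instance hs_fin_part {N : ℕ} (I : Ideal (MvPolynomial (Fin N) ℂ)) (k : ℕ) :
    FiniteDimensional ℂ (hsPart I k) :=
  Submodule.finiteDimensional_of_le (inf_le_left : _ ≤ homogeneousSubmodule (Fin N) ℂ k)

/-- Hilbert series of `S ⧸ I` -/
def hsSeries {N : ℕ} (I : Ideal (MvPolynomial (Fin N) ℂ)) : PowerSeries ℤ :=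
  PowerSeries.mk fun k => (Module.finrank ℂ (homogeneousSubmodule (Fin N) ℂ k) : ℤ)
    - Module.finrank ℂ (hsPart I k)

theorem hs_hom_sup {N : ℕ} {I : Ideal (MvPolynomial (Fin N) ℂ)} (hI : hsHom I)
    {f : MvPolynomial (Fin N) ℂ} {e : ℕ} (hf : f.IsHomogeneous e) :
    hsHom (I ⊔ Ideal.span {f}) := by
  intro g hg k
  obtain ⟨a, ha, c, hc, rfl⟩ := Submodule.mem_sup.mp hg
  obtain ⟨b, rfl⟩ := Ideal.mem_span_singleton.mp hc
  rw [map_add, hs_comp_mul hf]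
  apply Ideal.add_mem
  · exact Ideal.mem_sup_left (hI a ha k)
  · split_ifs
    · exact Ideal.mem_sup_right (Ideal.mul_mem_right _ _ (Ideal.mem_span_singleton_self f))
    · exact zero_mem _

theorem hs_finrank_map {N : ℕ} {f : MvPolynomial (Fin N) ℂ} (hf0 : f ≠ 0)
    (W : Submodule ℂ (MvPolynomial (Fin N) ℂ)) :
    Module.finrank ℂ (W.map (LinearMap.mulLeft ℂ f)) = Module.finrank ℂ W :=
  (LinearEquiv.finrank_eq (Submodule.equivMapOfInjective _
    (fun a b h => mul_left_cancel₀ hf0 h) W)).symm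

theorem hs_step {N : ℕ} {I : Ideal (MvPolynomial (Fin N) ℂ)} (hI : hsHom I)
    {f : MvPolynomial (Fin N) ℂ} {e : ℕ} (hf : f.IsHomogeneous e)
    (hf0 : f ≠ 0) (hreg : ∀ x, f * x ∈ I → x ∈ I) :
    hsSeries (I ⊔ Ideal.span {f}) = hsSeries I * (1 - PowerSeries.X ^ e) := by
  ext k
  rw [mul_sub, mul_one, map_sub, PowerSeries.coeff_mul_X_pow']
  simp only [hsSeries, PowerSeries.coeff_mk]
  split_ifs with h
  · have hsup : hsPart (I ⊔ Ideal.span {f}) k = hsPart I k ⊔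
        (homogeneousSubmodule (Fin N) ℂ (k - e)).map (LinearMap.mulLeft ℂ f) := by
      apply le_antisymm
      · rintro g ⟨hg1, hg2⟩
        obtain ⟨a, ha, c, hc, rfl⟩ := Submodule.mem_sup.mp hg2
        obtain ⟨b, rfl⟩ := Ideal.mem_span_singleton.mp hc
        rw [← homogeneousComponent_eq_self hg1, map_add, hs_comp_mul hf, if_pos h]
        exact Submodule.add_mem_sup ⟨homogeneousComponent_mem _ _, hI a ha k⟩
          ⟨_, homogeneousComponent_mem _ _, rfl⟩
      · apply sup_le
        · exact inf_le_inf_left _ (fun x hx => Ideal.mem_sup_left hx)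
        · rintro _ ⟨b, hb, rfl⟩
          refine ⟨?_, Ideal.mem_sup_right
            (Ideal.mul_mem_right _ _ (Ideal.mem_span_singleton_self f))⟩
          have := hf.mul hb
          rwa [Nat.add_sub_cancel' h] at this
    have hinf : hsPart I k ⊓
        (homogeneousSubmodule (Fin N) ℂ (k - e)).map (LinearMap.mulLeft ℂ f) =
        (hsPart I (k - e)).map (LinearMap.mulLeft ℂ f) := by
      apply le_antisymm
      · rintro _ ⟨hg, b, hb, rfl⟩
        exact ⟨b, ⟨hb, hreg b hg.2⟩, rfl⟩
      · rintro _ ⟨b, hb, rfl⟩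
        refine ⟨⟨?_, Ideal.mul_mem_left _ _ hb.2⟩, b, hb.1, rfl⟩
        have := hf.mul hb.1
        rwa [Nat.add_sub_cancel' h] at this
    have := Submodule.finrank_sup_add_finrank_inf_eq (hsPart I k)
      ((homogeneousSubmodule (Fin N) ℂ (k - e)).map (LinearMap.mulLeft ℂ f))
    rw [← hsup, hinf, hs_finrank_map hf0, hs_finrank_map hf0] at this
    omega
  · have : hsPart (I ⊔ Ideal.span {f}) k = hsPart I k := by
      apply le_antisymm
      · rintro g ⟨hg1, hg2⟩
        obtain ⟨a, ha, c, hc, rfl⟩ := Submodule.mem_sup.mp hg2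
        obtain ⟨b, rfl⟩ := Ideal.mem_span_singleton.mp hc
        rw [← homogeneousComponent_eq_self hg1, map_add, hs_comp_mul hf, if_neg h, add_zero]
        exact ⟨homogeneousComponent_mem _ _, hI a ha k⟩
      · exact inf_le_inf_left _ (fun x hx => Ideal.mem_sup_left hx)
    rw [this, sub_zero]

theorem hs_finrank (N k : ℕ) :
    Module.finrank ℂ (homogeneousSubmodule (Fin (N + 1)) ℂ k) = (N + k).choose N := by
  have h1 : Module.finrank ℂ (homogeneousSubmodule (Fin (N + 1)) ℂ k) =
      Nat.card {d : Fin (N + 1) →₀ ℕ // d.degree = k} := by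
    rw [homogeneousSubmodule_eq_finsupp_supported]
    rw [LinearEquiv.finrank_eq (AddMonoidAlgebra.supportedEquivFinsupp _)]
    exact Module.finrank_eq_nat_card_basis (Finsupp.basisSingleOne)
  rw [h1]
  have h2 := Nat.card_congr (Sym.equivNatSum (Fin (N + 1)) k)
  rw [Nat.card_eq_fintype_card, Sym.card_sym_eq_choose] at h2
  have h3 : (N + k).choose N = (N + k).choose k := by
    rw [Nat.choose_symm_add]
  rw [h3]
  simp only [Fintype.card_fin] at h2
  rw [show N + 1 + k - 1 = N + k by omega] at h2
  rw [h2]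
  rfl

theorem hs_bot (N : ℕ) (hN : 1 ≤ N) :
    hsSeries (⊥ : Ideal (MvPolynomial (Fin N) ℂ)) * (1 - PowerSeries.X) ^ N = 1 := by
  obtain ⟨n, rfl⟩ : ∃ n, N = n + 1 := ⟨N - 1, by omega⟩
  refine Eq.trans ?_ (PowerSeries.mk_add_choose_mul_one_sub_pow_eq_one ℤ n)
  congr 1
  ext k
  have : hsPart (⊥ : Ideal (MvPolynomial (Fin (n + 1)) ℂ)) k = ⊥ := by
    rw [eq_bot_iff]
    rintro x ⟨_, hx⟩
    exact hx
  simp [hsSeries, hs_finrank, this]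

theorem hs_list {N : ℕ} (hN : 1 ≤ N) (f : Fin N → MvPolynomial (Fin N) ℂ) (e : Fin N → ℕ)
    (hf : ∀ i, (f i).IsHomogeneous (e i)) (hf0 : ∀ i, f i ≠ 0)
    (hreg : ∀ i : Fin N, ∀ x, f i * x ∈ Ideal.ofList ((List.ofFn f).take i) →
      x ∈ Ideal.ofList ((List.ofFn f).take i)) (j : ℕ) (hj : j ≤ N) :
    hsHom (Ideal.ofList ((List.ofFn f).take j)) ∧
    hsSeries (Ideal.ofList ((List.ofFn f).take j)) * (1 - PowerSeries.X) ^ N =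
      ∏ i : Fin j, (1 - PowerSeries.X ^ (e (Fin.castLE hj i))) := by
  induction j with
  | zero =>
    simp only [List.take_zero, Ideal.ofList_nil]
    refine ⟨?_, by simpa using hs_bot N hN⟩
    intro g hg k
    rw [Ideal.mem_bot] at hg
    simp [hg]
  | succ j ih =>
    obtain ⟨h1, h2⟩ := ih (by omega)
    have hlt : j < N := hj
    have e1 : Ideal.ofList ((List.ofFn f).take (j + 1)) =
        Ideal.ofList ((List.ofFn f).take j) ⊔ Ideal.span {f ⟨j, hlt⟩} := by
      rw [List.take_add_one, List.getElem?_eq_getElem (by simpa using hlt)]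
      simp [Ideal.ofList_singleton]
    rw [e1]
    refine ⟨hs_hom_sup h1 (hf _), ?_⟩
    rw [hs_step h1 (hf _) (hf0 _) (hreg ⟨j, hlt⟩), mul_right_comm, h2, Fin.prod_univ_castSucc]
    rfl

theorem hs_main
    (N : ℕ) (hN : 1 ≤ N) (f : Fin N → MvPolynomial (Fin N) ℂ) (e : Fin N → ℕ)
    (he : ∀ i, 1 ≤ e i) (hf : ∀ i, (f i).IsHomogeneous (e i))
    (hreg : RingTheory.Sequence.IsRegular (MvPolynomial (Fin N) ℂ) (List.ofFn f))
    (k : ℕ) (g : MvPolynomial (Fin N) ℂ) (hk : (∑ i : Fin N, (e i - 1)) < k)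
    (hg : g.IsHomogeneous k) : g ∈ Ideal.span (Set.range f) := by
  have hreg' : ∀ i : Fin N, ∀ x, f i * x ∈ Ideal.ofList ((List.ofFn f).take i) →
      x ∈ Ideal.ofList ((List.ofFn f).take i) := by
    intro i x hx
    have h := hreg.toIsWeaklyRegular.regular_mod_prev i (by simp)
    rw [isSMulRegular_quotient_iff_mem_of_smul_mem] at h
    simpa using h x (by simpa using hx)
  have hall : Ideal.ofList ((List.ofFn f).take N) = Ideal.span (Set.range f) := by
    rw [List.take_of_length_le (by simp)]
    unfold Ideal.ofList
    congr 1
    ext x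
    simp [List.mem_ofFn]
  have hne : Ideal.span (Set.range f) ≠ ⊤ := by
    have h := hreg.top_ne_smul
    rw [← hall, List.take_of_length_le (by simp)]
    intro h'
    apply h
    rw [h']
    simp
  have hf0 : ∀ i, f i ≠ 0 := by
    intro i h0
    have h1 : (1 : MvPolynomial (Fin N) ℂ) ∈ Ideal.ofList ((List.ofFn f).take i) :=
      hreg' i 1 (by rw [h0, zero_mul]; exact zero_mem _)
    apply hne
    rw [Ideal.eq_top_iff_one, ← hall]
    refine Ideal.span_mono ?_ h1
    intro x hx
    exact List.take_subset_take_left _ i.2.le hx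
  obtain ⟨-, hser⟩ := hs_list hN f e hf hf0 hreg' N le_rfl
  rw [hall] at hser
  have hP : hsSeries (Ideal.span (Set.range f)) =
      ((∏ i : Fin N, ∑ j ∈ Finset.range (e i), (Polynomial.X : Polynomial ℤ) ^ j :
        Polynomial ℤ) : PowerSeries ℤ) := by
    have hu : ((1 - PowerSeries.X : PowerSeries ℤ)) ^ N ≠ 0 := by
      intro h
      have := hs_bot N hN
      rw [h, mul_zero] at this
      exact zero_ne_one this
    apply mul_right_cancel₀ hu
    rw [hser]
    have h2 : (∏ i : Fin N, (1 - (PowerSeries.X : PowerSeries ℤ) ^ e i)) =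
        (((∏ i : Fin N, ∑ j ∈ Finset.range (e i), (Polynomial.X : Polynomial ℤ) ^ j) *
          (1 - Polynomial.X) ^ N : Polynomial ℤ) : PowerSeries ℤ) := by
      have h3 : (∏ i : Fin N, ∑ j ∈ Finset.range (e i), (Polynomial.X : Polynomial ℤ) ^ j) *
          (1 - Polynomial.X) ^ N = ∏ i : Fin N, (1 - (Polynomial.X : Polynomial ℤ) ^ e i) := by
        rw [← Fin.prod_const N (1 - (Polynomial.X : Polynomial ℤ)), ← Finset.prod_mul_distrib]
        exact Finset.prod_congr rfl fun i _ => geom_sum_mul_neg _ _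
      rw [h3, ← Polynomial.coeToPowerSeries.ringHom_apply, map_prod]
      simp
    rw [Polynomial.coe_mul, Polynomial.coe_pow, Polynomial.coe_sub, Polynomial.coe_one,
      Polynomial.coe_X] at h2
    exact h2
  have hc : PowerSeries.coeff k (hsSeries (Ideal.span (Set.range f))) = 0 := by
    rw [hP, Polynomial.coeff_coe]
    apply Polynomial.coeff_eq_zero_of_natDegree_lt
    refine lt_of_le_of_lt ?_ hk
    refine (Polynomial.natDegree_prod_le _ _).trans (Finset.sum_le_sum fun i _ => ?_)
    refine Polynomial.natDegree_sum_le_of_forall_le _ _ fun j hj => ?_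
    rw [Polynomial.natDegree_X_pow]
    have := Finset.mem_range.mp hj
    omega
  simp only [hsSeries, PowerSeries.coeff_mk] at hc
  have heq : hsPart (Ideal.span (Set.range f)) k = homogeneousSubmodule (Fin N) ℂ k :=
    Submodule.eq_of_le_of_finrank_eq inf_le_left (by omega)
  have : g ∈ hsPart (Ideal.span (Set.range f)) k := by rw [heq]; exact hg
  exact this.2

/-- Graded pieces of an Artinian complete intersection vanish above the socle degree
`σ = ∑ (e_i - 1)`; equivalently every homogeneous polynomial of degree `> σ` lies in the ideal. -/
theorem graded_pieces_vanish_above_socle_degree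
    (N : ℕ) (hN : 1 ≤ N) (f : Fin N → MvPolynomial (Fin N) ℂ) (e : Fin N → ℕ)
    (he : ∀ i, 1 ≤ e i) (hf : ∀ i, (f i).IsHomogeneous (e i))
    (hreg : RingTheory.Sequence.IsRegular (MvPolynomial (Fin N) ℂ) (List.ofFn f)) :
    (∀ k : ℕ, (∑ i : Fin N, (e i - 1)) < k → gradedPiece (Ideal.span (Set.range f)) k = ⊥) ∧
    (∀ (k : ℕ) (g : MvPolynomial (Fin N) ℂ), (∑ i : Fin N, (e i - 1)) < k →
      g.IsHomogeneous k → g ∈ Ideal.span (Set.range f)) := by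
  have H := hs_main N hN f e he hf hreg
  refine ⟨fun k hk => ?_, H⟩
  rw [eq_bot_iff]
  rintro _ ⟨g, hg, rfl⟩
  exact (Submodule.mem_bot ℂ).mpr (Ideal.Quotient.eq_zero_iff_mem.mpr (H k g hk hg))
end
end

section
/- (Symmetry of the Hilbert function of an Artinian complete intersection.) Let N ≥ 1 and let f_1,…,f_N ∈ S = ℂ[x_1,…,x_N] be homogeneous polynomials of degrees e_1,…,e_N ≥ 1 forming a regular sequence, and let R = S ⧸ (f_1,…,f_N) and σ = ∑_{i=1}^N (e_i − 1). Then for every 0 ≤ k ≤ σ, dim_ℂ R_k = dim_ℂ R_{σ−k}. -/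
noncomputable section

open MvPolynomial

section Aux
attribute [local instance] MvPolynomial.gradedAlgebra

lemma aux_comp_mul {N : ℕ} (g f : MvPolynomial (Fin N) ℂ) (d n : ℕ) (hf : f.IsHomogeneous d) :
    homogeneousComponent n (g * f) =
      if d ≤ n then homogeneousComponent (n - d) g * f else 0 := by
  have h := DirectSum.coe_decompose_mul_of_right_mem (𝒜 := homogeneousSubmodule (Fin N) ℂ)
    (a := g) (b := f) n (i := d) hf
  have h2 : ∀ (p : MvPolynomial (Fin N) ℂ) i,
      (DirectSum.decompose (homogeneousSubmodule (Fin N) ℂ) p i : MvPolynomial (Fin N) ℂ)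
        = homogeneousComponent i p := fun p i => decomposition.decompose'_apply p i
  rw [h2, h2] at h
  exact h
end Aux

/-- closed under homogeneous components -/
def AuxHom {N : ℕ} (I : Ideal (MvPolynomial (Fin N) ℂ)) : Prop :=
  ∀ p ∈ I, ∀ n, homogeneousComponent n p ∈ I

lemma AuxHom.sup {N : ℕ} {I : Ideal (MvPolynomial (Fin N) ℂ)} (hI : AuxHom I)
    {f : MvPolynomial (Fin N) ℂ} {d : ℕ} (hf : f.IsHomogeneous d) :
    AuxHom (I ⊔ Ideal.span {f}) := by
  intro p hp n
  obtain ⟨a, ha, b, hb, rfl⟩ := Submodule.mem_sup.1 hp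
  obtain ⟨c, rfl⟩ := Ideal.mem_span_singleton'.1 hb
  rw [map_add, aux_comp_mul _ _ _ _ hf]
  refine add_mem (Ideal.mem_sup_left (hI a ha n)) (Ideal.mem_sup_right ?_)
  split_ifs
  · exact Ideal.mul_mem_left _ _ (Ideal.mem_span_singleton_self f)
  · exact zero_mem _

instance aux_fin {N : ℕ} (I : Ideal (MvPolynomial (Fin N) ℂ)) (k : ℕ) :
    FiniteDimensional ℂ (gradedPiece I k) :=
  Module.Finite.iff_fg.2 ((homogeneousSubmodule_fg (Fin N) ℂ k).map _)

lemma aux_step {N : ℕ} {I : Ideal (MvPolynomial (Fin N) ℂ)} (hI : AuxHom I)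
    {f : MvPolynomial (Fin N) ℂ} {d : ℕ} (hf : f.IsHomogeneous d)
    (hreg : ∀ g, f * g ∈ I → g ∈ I) (k : ℕ) :
    Module.finrank ℂ (gradedPiece (I ⊔ Ideal.span {f}) k) +
      (if d ≤ k then Module.finrank ℂ (gradedPiece I (k - d)) else 0) =
    Module.finrank ℂ (gradedPiece I k) := by
  set J := I ⊔ Ideal.span {f} with hJ
  have hIJ : I ≤ J := le_sup_left
  let φ := (Ideal.Quotient.factorₐ ℂ hIJ).toLinearMap
  have hmap : (gradedPiece I k).map φ = gradedPiece J k := by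
    unfold gradedPiece
    rw [← Submodule.map_comp]
    rfl
  have hrn := LinearMap.finrank_range_add_finrank_ker (φ.domRestrict (gradedPiece I k))
  rw [LinearMap.range_domRestrict, hmap] at hrn
  rw [← hrn]
  congr 1
  have hker : (LinearMap.ker (φ.domRestrict (gradedPiece I k))).map (gradedPiece I k).subtype =
      if d ≤ k then (gradedPiece I (k - d)).map (mulMap I f) else ⊥ := by
    ext x
    constructor
    · rintro ⟨⟨y, hy⟩, hy0, rfl⟩
      obtain ⟨p, hp, rfl⟩ := hy
      have hpJ : p ∈ J := Ideal.Quotient.eq_zero_iff_mem.1 hy0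
      obtain ⟨a, ha, b, hb, hab⟩ := Submodule.mem_sup.1 hpJ
      obtain ⟨c, rfl⟩ := Ideal.mem_span_singleton'.1 hb
      have h1 := congrArg (homogeneousComponent k) hab
      rw [map_add, aux_comp_mul _ _ _ _ hf, homogeneousComponent_eq_self hp] at h1
      have h2 := hI a ha k
      split_ifs with hk
      · rw [if_pos hk] at h1
        refine ⟨Ideal.Quotient.mk I (homogeneousComponent (k - d) c),
          ⟨_, homogeneousComponent_mem _ _, rfl⟩, ?_⟩
        change Ideal.Quotient.mk I f * Ideal.Quotient.mk I _ = Ideal.Quotient.mk I p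
        rw [← map_mul, eq_comm, Ideal.Quotient.eq, ← h1]
        convert h2 using 1
        ring
      · rw [if_neg hk, add_zero] at h1
        rw [Submodule.mem_bot]
        exact Ideal.Quotient.eq_zero_iff_mem.2 (h1 ▸ h2)
    · intro hx
      split_ifs at hx with hk
      · obtain ⟨y, ⟨p, hp, rfl⟩, rfl⟩ := hx
        refine ⟨⟨Ideal.Quotient.mk I (f * p), ⟨f * p, ?_, rfl⟩⟩, ?_, ?_⟩
        · have := hf.mul hp
          rwa [Nat.add_sub_cancel' hk] at this
        · refine Ideal.Quotient.eq_zero_iff_mem.2 (Ideal.mem_sup_right ?_)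
          exact Ideal.mul_mem_right _ _ (Ideal.mem_span_singleton_self f)
        · exact map_mul (Ideal.Quotient.mk I) f p
      · rw [Submodule.mem_bot] at hx
        rw [hx]
        exact zero_mem _
  have hinj : Function.Injective (mulMap I f) := by
    rw [injective_iff_map_eq_zero]
    intro y hy
    obtain ⟨p, rfl⟩ := Ideal.Quotient.mk_surjective y
    refine Ideal.Quotient.eq_zero_iff_mem.2 (hreg p (Ideal.Quotient.eq_zero_iff_mem.1 ?_))
    rw [map_mul]; exact hy
  rw [LinearEquiv.finrank_eq (Submodule.equivMapOfInjective _
    (gradedPiece I k).injective_subtype (LinearMap.ker (φ.domRestrict (gradedPiece I k)))), hker]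
  split_ifs with hk
  · rw [if_pos hk]
    exact (LinearEquiv.finrank_eq (Submodule.equivMapOfInjective _ hinj _))
  · rw [if_neg hk, finrank_bot]

/-- Hilbert series -/
def auxH {N : ℕ} (I : Ideal (MvPolynomial (Fin N) ℂ)) : PowerSeries ℤ :=
  PowerSeries.mk fun k => (Module.finrank ℂ (gradedPiece I k) : ℤ)

lemma auxH_step {N : ℕ} {I : Ideal (MvPolynomial (Fin N) ℂ)} (hI : AuxHom I)
    {f : MvPolynomial (Fin N) ℂ} {d : ℕ} (hf : f.IsHomogeneous d)
    (hreg : ∀ g, f * g ∈ I → g ∈ I) :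
    auxH (I ⊔ Ideal.span {f}) = auxH I * (1 - PowerSeries.X ^ d) := by
  ext k
  rw [mul_sub, mul_one, map_sub, PowerSeries.coeff_mul_X_pow']
  simp only [auxH, PowerSeries.coeff_mk]
  rw [← aux_step hI hf hreg k]
  split_ifs <;> simp

lemma auxH_bot (N : ℕ) :
    auxH (⊥ : Ideal (MvPolynomial (Fin N) ℂ)) * (1 - PowerSeries.X) ^ N = 1 := by
  have h : auxH (⊥ : Ideal (MvPolynomial (Fin N) ℂ)) =
      ∏ _i : Fin N, (PowerSeries.mk 1 : PowerSeries ℤ) := by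
    ext k
    rw [PowerSeries.coeff_prod]
    simp only [auxH, PowerSeries.coeff_mk, Pi.one_apply, Finset.prod_const_one,
      Finset.sum_const, nsmul_eq_mul, mul_one]
    congr 1
    have hinj : Function.Injective
        (Ideal.Quotient.mkₐ ℂ (⊥ : Ideal (MvPolynomial (Fin N) ℂ))).toLinearMap := by
      rw [injective_iff_map_eq_zero]
      intro y hy
      exact Ideal.Quotient.eq_zero_iff_mem.1 hy
    rw [gradedPiece, ← LinearEquiv.finrank_eq (Submodule.equivMapOfInjective _ hinj _),
      homogeneousSubmodule_eq_finsupp_supported,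
      LinearEquiv.finrank_eq (AddMonoidAlgebra.supportedEquivFinsupp _)]
    have hset : {d : Fin N →₀ ℕ | d.degree = k} =
        ((Finset.univ.finsuppAntidiag k : Finset (Fin N →₀ ℕ)) : Set (Fin N →₀ ℕ)) := by
      ext d
      simp [Finset.mem_finsuppAntidiag, Finsupp.degree_eq_sum]
    rw [hset, Module.finrank_finsupp_self]
    simp
  rw [h, Finset.prod_const, Finset.card_univ, Fintype.card_fin, ← mul_pow,
    PowerSeries.mk_one_mul_one_sub_eq_one, one_pow]

lemma aux_reflect {ι : Type*} (s : Finset ι) (e : ι → ℕ) (he : ∀ i, 1 ≤ e i) :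
    (∏ i ∈ s, ∑ j ∈ Finset.range (e i), (Polynomial.X : Polynomial ℤ) ^ j).natDegree
      ≤ ∑ i ∈ s, (e i - 1) ∧
    Polynomial.reflect (∑ i ∈ s, (e i - 1))
      (∏ i ∈ s, ∑ j ∈ Finset.range (e i), (Polynomial.X : Polynomial ℤ) ^ j) =
      ∏ i ∈ s, ∑ j ∈ Finset.range (e i), (Polynomial.X : Polynomial ℤ) ^ j := by
  classical
  induction s using Finset.induction_on with
  | empty =>
    refine ⟨by simp, ?_⟩
    rw [Finset.sum_empty, Finset.prod_empty, Polynomial.reflect_one, pow_zero]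
  | insert a s ha ih =>
    rw [Finset.prod_insert ha, Finset.sum_insert ha]
    have hd : (∑ j ∈ Finset.range (e a), (Polynomial.X : Polynomial ℤ) ^ j).natDegree
        ≤ e a - 1 := by
      refine Polynomial.natDegree_sum_le_of_forall_le _ _ fun j hj => ?_
      rw [Polynomial.natDegree_X_pow]
      have := Finset.mem_range.1 hj
      omega
    refine ⟨Polynomial.natDegree_mul_le_of_le hd ih.1, ?_⟩
    rw [Polynomial.reflect_mul _ _ hd ih.1, ih.2]
    congr 1
    ext n
    rw [Polynomial.coeff_reflect]
    simp only [Polynomial.finsetSum_coeff, Polynomial.coeff_X_pow, Finset.sum_ite_eq,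
      Finset.mem_range]
    have := he a
    by_cases h : n ≤ e a - 1
    · rw [Polynomial.revAt_le h, if_pos (by omega), if_pos (by omega)]
    · rw [Polynomial.revAt_eq_self_of_lt (by omega)]

lemma auxH_main (N : ℕ) (f : Fin N → MvPolynomial (Fin N) ℂ) (e : Fin N → ℕ)
    (hf : ∀ i, (f i).IsHomogeneous (e i))
    (hreg : RingTheory.Sequence.IsRegular (MvPolynomial (Fin N) ℂ) (List.ofFn f)) :
    auxH (Ideal.span (Set.range f)) * (1 - PowerSeries.X) ^ N =
      ∏ i, (1 - PowerSeries.X ^ (e i)) := by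
  have key : ∀ j, j ≤ N → AuxHom (Ideal.ofList ((List.ofFn f).take j)) ∧
      auxH (Ideal.ofList ((List.ofFn f).take j)) * (1 - PowerSeries.X) ^ N =
        ∏ i with i.val < j, (1 - PowerSeries.X ^ (e i)) := by
    intro j
    induction j with
    | zero =>
      intro _
      refine ⟨?_, ?_⟩
      · intro p hp n
        simp at hp
        simp [hp]
      · simp [auxH_bot]
    | succ j ih =>
      intro hj
      obtain ⟨h1, h2⟩ := ih (by omega)
      have hlen : j < (List.ofFn f).length := by simp; omega
      have hr := hreg.toIsWeaklyRegular.regular_mod_prev j hlen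
      have hrr : ∀ g, f ⟨j, hj⟩ * g ∈ Ideal.ofList ((List.ofFn f).take j) →
          g ∈ Ideal.ofList ((List.ofFn f).take j) := by
        intro g hg
        rw [isSMulRegular_iff_right_eq_zero_of_smul] at hr
        have := hr (Submodule.Quotient.mk g) (by
          rw [← Submodule.Quotient.mk_smul, Submodule.Quotient.mk_eq_zero]
          simpa using hg)
        rw [Submodule.Quotient.mk_eq_zero] at this
        simpa using this
      have heq : Ideal.ofList ((List.ofFn f).take (j+1)) =
          Ideal.ofList ((List.ofFn f).take j) ⊔ Ideal.span {f ⟨j, hj⟩} := by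
        rw [← List.take_append_getElem hlen, Ideal.ofList_append, Ideal.ofList_singleton]
        simp
      rw [heq]
      refine ⟨h1.sup (hf _), ?_⟩
      rw [auxH_step h1 (hf _) hrr, mul_right_comm, h2]
      have hs : (Finset.univ.filter fun i : Fin N => i.val < j + 1) =
          insert ⟨j, hj⟩ (Finset.univ.filter fun i : Fin N => i.val < j) := by
        ext i
        simp [Fin.ext_iff]
        omega
      rw [hs, Finset.prod_insert (by simp), mul_comm]
  have := (key N le_rfl).2
  have hI : Ideal.ofList ((List.ofFn f).take N) = Ideal.span (Set.range f) := by
    rw [List.take_of_length_le (by simp), Ideal.ofList]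
    congr 1
    ext x
    simp [List.mem_ofFn]
  rw [hI] at this
  simpa using this

/-- Symmetry of the Hilbert function of an Artinian complete intersection:
`dim_ℂ R_k = dim_ℂ R_{σ-k}` for `0 ≤ k ≤ σ`, where `σ = ∑ (e_i - 1)`. -/
theorem hilbert_function_symmetric
    (N : ℕ) (hN : 1 ≤ N) (f : Fin N → MvPolynomial (Fin N) ℂ) (e : Fin N → ℕ)
    (he : ∀ i, 1 ≤ e i) (hf : ∀ i, (f i).IsHomogeneous (e i))
    (hreg : RingTheory.Sequence.IsRegular (MvPolynomial (Fin N) ℂ) (List.ofFn f))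
    (k : ℕ) (hk : k ≤ ∑ i : Fin N, (e i - 1)) :
    Module.finrank ℂ (gradedPiece (Ideal.span (Set.range f)) k)
      = Module.finrank ℂ (gradedPiece (Ideal.span (Set.range f)) ((∑ i : Fin N, (e i - 1)) - k)) := by
  have hmain := auxH_main N f e hf hreg
  have hH : auxH (Ideal.span (Set.range f)) =
      ((∏ i, ∑ j ∈ Finset.range (e i), (Polynomial.X : Polynomial ℤ) ^ j : Polynomial ℤ) :
        PowerSeries ℤ) := by
    have hne : ((1 - PowerSeries.X : PowerSeries ℤ)) ^ N ≠ 0 := by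
      intro h0
      have := auxH_bot N
      rw [h0, mul_zero] at this
      exact zero_ne_one this
    apply mul_right_cancel₀ hne
    rw [hmain]
    have h3 : ((1 - PowerSeries.X : PowerSeries ℤ)) ^ N =
        ((∏ _i : Fin N, (1 - Polynomial.X) : Polynomial ℤ) : PowerSeries ℤ) := by
      simp
    rw [h3, ← Polynomial.coe_mul, ← Finset.prod_mul_distrib]
    simp only [geom_sum_mul_neg]
    rw [← Polynomial.coeToPowerSeries.ringHom_apply, map_prod]
    simp
  have hc : ∀ n, (Module.finrank ℂ (gradedPiece (Ideal.span (Set.range f)) n) : ℤ) =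
      (∏ i, ∑ j ∈ Finset.range (e i), (Polynomial.X : Polynomial ℤ) ^ j).coeff n := by
    intro n
    have := congrArg (PowerSeries.coeff n) hH
    rwa [auxH, PowerSeries.coeff_mk, Polynomial.coeff_coe] at this
  have hr := congrArg (fun p => Polynomial.coeff p k) (aux_reflect Finset.univ e he).2
  simp only [Polynomial.coeff_reflect] at hr
  rw [Polynomial.revAt_le hk, ← hc, ← hc] at hr
  exact_mod_cast hr.symm
end
end
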